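/- arXiv:0802.2998 — 2 statements merged into one kernel-verified Lean document; each statement's English description precedes it below -/
import Mathlib

section
/- Let d ≥ 2, let 1 < α < 2, and let Γ be a finite Borel measure on the unit sphere S_d of ℝ^d that is invariant under the symmetry s ↦ −s. Define φ : ℝ^d → ℝ by φ(θ) = ∫_{S_d} cos(Σ_{i=1}^d θ_i s_i) dΓ(s). Assume that for all indices i, j, k ∈ {1,…,d} that are not all equal, the third mixed partial derivative ∂³φ/∂θ_i∂θ_j∂θ_k vanishes identically on ℝ^d. Then for every i₀ ∈ {1,…,d} and all θ₁,…,θ_d ∈ ℝ: ∫_{S_d} s_{i₀} · (Σ_{j=1}^d θ_j s_j)^{<α−1>} dΓ(s) = Σ_{j=1}^d ∫_{S_d} s_{i₀} · (θ_j s_j)^{<α−1>} dΓ(s). -/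
open MeasureTheory Real

/-- Signed power: `s^{<β>} = sign(s) * |s|^β`. -/
noncomputable def spow (s β : ℝ) : ℝ := Real.sign s * |s| ^ β

/-- Partial derivative of `f : ℝ^d → ℝ` in the `i`-th coordinate direction. -/
noncomputable def pderiv' {d : ℕ} (i : Fin d) (f : (Fin d → ℝ) → ℝ) : (Fin d → ℝ) → ℝ :=
  fun θ => deriv (fun t : ℝ => f (Function.update θ i t)) (θ i)

lemma pd_aux {d : ℕ} (Γ : Measure (EuclideanSpace ℝ (Fin d))) [IsFiniteMeasure Γ]
    (hs : ∀ᵐ s ∂Γ, ‖s‖ = 1) (g : EuclideanSpace ℝ (Fin d) → ℝ) (hg : Measurable g)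
    (hb : ∀ s, ‖s‖ = 1 → |g s| ≤ 1) (c : ℝ) (i : Fin d) :
    pderiv' i (fun θ => ∫ s, g s * Real.cos (∑ l, θ l * s l + c) ∂Γ)
      = fun θ => ∫ s, (g s * s i) * Real.cos (∑ l, θ l * s l + (c + π / 2)) ∂Γ := by
  funext θ
  have hcoord : ∀ l : Fin d, Measurable (fun s : EuclideanSpace ℝ (Fin d) => s l) := by
    intro l; fun_prop
  have hsum : ∀ η : Fin d → ℝ, ∀ c : ℝ,
      Measurable (fun s : EuclideanSpace ℝ (Fin d) => Real.cos (∑ l, η l * s l + c)) := by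
    intro η c; fun_prop
  have hup : ∀ (t : ℝ) (s : EuclideanSpace ℝ (Fin d)),
      ∑ l, Function.update θ i t l * s l = ∑ l, θ l * s l + (t - θ i) * s i := by
    intro t s
    rw [← sub_eq_iff_eq_add', ← Finset.sum_sub_distrib, Finset.sum_eq_single i]
    · simp; ring
    · intro b _ hbi; simp [Function.update_of_ne hbi]
    · simp
  have key := hasDerivAt_integral_of_dominated_loc_of_deriv_le (μ := Γ)
    (F := fun t s => g s * Real.cos (∑ l, Function.update θ i t l * s l + c))
    (F' := fun t s => (g s * s i) * Real.cos (∑ l, Function.update θ i t l * s l + (c + π / 2)))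
    (x₀ := θ i) (s := Set.univ) (bound := fun _ => 1) Filter.univ_mem
    (Filter.Eventually.of_forall fun t => (hg.mul (hsum _ _)).aestronglyMeasurable)
    (by
      refine Integrable.of_bound (C := 1) (hg.mul (hsum _ _)).aestronglyMeasurable ?_
      filter_upwards [hs] with s h
      rw [Real.norm_eq_abs, abs_mul]
      exact mul_le_one₀ (hb s h) (abs_nonneg _) (Real.abs_cos_le_one _))
    ((hg.mul (hcoord i)).mul (hsum _ _)).aestronglyMeasurable
    (by
      filter_upwards [hs] with s h t _
      rw [Real.norm_eq_abs, abs_mul, abs_mul]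
      have h1 : |s i| ≤ 1 := by
        have := PiLp.norm_apply_le s i
        rwa [h] at this
      exact mul_le_one₀ (mul_le_one₀ (hb s h) (abs_nonneg _) h1) (abs_nonneg _)
        (Real.abs_cos_le_one _))
    (integrable_const _)
    (by
      refine Filter.Eventually.of_forall fun s t _ => ?_
      simp only [hup]
      have h1 : HasDerivAt (fun t : ℝ => ∑ l, θ l * s l + (t - θ i) * s i + c) (1 * s i) t :=
        ((((hasDerivAt_id t).sub_const (θ i)).mul_const (s i)).const_add _).add_const c
      have h2 := (h1.cos).const_mul (g s)
      refine h2.congr_deriv ?_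
      rw [← add_assoc, Real.cos_add_pi_div_two]; ring)
  have := key.2.deriv
  simp only [Function.update_eq_self] at this
  exact this

lemma spow_bound (x β : ℝ) (hβ : 0 ≤ β) (C : ℝ) (hx : |x| ≤ C) : |spow x β| ≤ C ^ β := by
  unfold spow
  rw [abs_mul, abs_of_nonneg (Real.rpow_nonneg (abs_nonneg x) β)]
  have h1 : |Real.sign x| ≤ 1 := by
    rcases Real.sign_apply_eq x with h | h | h <;> simp [h]
  calc _ ≤ 1 * |x| ^ β := by gcongr
    _ ≤ C ^ β := by rw [one_mul]; gcongr

lemma spow_meas (β : ℝ) : Measurable (fun x => spow x β) := by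
  unfold spow
  have : Measurable Real.sign := by
    unfold Real.sign
    exact Measurable.ite measurableSet_Iio measurable_const
      (Measurable.ite measurableSet_Ioi measurable_const measurable_const)
  fun_prop

theorem stmt0 (d : ℕ) (hd : 2 ≤ d) (α : ℝ) (hα1 : 1 < α) (hα2 : α < 2)
    (Γ : Measure (EuclideanSpace ℝ (Fin d))) [IsFiniteMeasure Γ]
    (hsupp : Γ {s : EuclideanSpace ℝ (Fin d) | ‖s‖ = 1}ᶜ = 0)
    (hsym : Γ.map (fun s => -s) = Γ)
    (φ : (Fin d → ℝ) → ℝ)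
    (hφ : ∀ θ, φ θ = ∫ s, Real.cos (∑ i, θ i * s i) ∂Γ)
    (hvanish : ∀ i j k : Fin d, ¬(i = j ∧ j = k) →
      ∀ θ, pderiv' i (pderiv' j (pderiv' k φ)) θ = 0) :
    ∀ (i₀ : Fin d) (θ : Fin d → ℝ),
      ∫ s, s i₀ * spow (∑ j, θ j * s j) (α - 1) ∂Γ
        = ∑ j, ∫ s, s i₀ * spow (θ j * s j) (α - 1) ∂Γ := by
  have hs : ∀ᵐ s ∂Γ, ‖s‖ = 1 := hsupp
  have hc1 : ∀ (s : EuclideanSpace ℝ (Fin d)), ‖s‖ = 1 → ∀ l, |s l| ≤ 1 := by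
    intro s h l
    have := PiLp.norm_apply_le s l
    rwa [h] at this
  have hcoord : ∀ l : Fin d, Measurable (fun s : EuclideanSpace ℝ (Fin d) => s l) := by
    intro l; fun_prop
  have hax : ∀ i j : Fin d, i ≠ j → ∀ᵐ s ∂Γ, s i * s j = 0 := by
    intro i j hij
    have e0 : φ = fun θ => ∫ s, (1 : ℝ) * Real.cos (∑ l, θ l * s l + 0) ∂Γ := by
      funext θ; simp [hφ]
    have hv := hvanish i i j (by tauto)
    have b1 : ∀ s : EuclideanSpace ℝ (Fin d), ‖s‖ = 1 → |1 * s j| ≤ 1 := by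
      intro s h; simpa using hc1 s h j
    have b2 : ∀ s : EuclideanSpace ℝ (Fin d), ‖s‖ = 1 → |1 * s j * s i| ≤ 1 := by
      intro s h; rw [abs_mul]; exact mul_le_one₀ (b1 s h) (abs_nonneg _) (hc1 s h i)
    have b3 : ∀ s : EuclideanSpace ℝ (Fin d), ‖s‖ = 1 → |1 * s j * s i * s i| ≤ 1 := by
      intro s h; rw [abs_mul]; exact mul_le_one₀ (b2 s h) (abs_nonneg _) (hc1 s h i)
    have b4 : ∀ s : EuclideanSpace ℝ (Fin d), ‖s‖ = 1 → |1 * s j * s i * s i * s j| ≤ 1 := by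
      intro s h; rw [abs_mul]; exact mul_le_one₀ (b3 s h) (abs_nonneg _) (hc1 s h j)
    rw [e0, pd_aux Γ hs (fun _ => 1) measurable_const (by simp) 0 j,
      pd_aux Γ hs (fun s => 1 * s j) (by fun_prop) b1 _ i,
      pd_aux Γ hs (fun s => 1 * s j * s i) (by fun_prop) b2 _ i] at hv
    have h4 := pd_aux Γ hs (fun s => 1 * s j * s i * s i) (by fun_prop) b3
      (0 + π / 2 + π / 2 + π / 2) j
    rw [funext hv] at h4
    have h5 := congrFun h4 0
    have hpi : 0 + π / 2 + π / 2 + π / 2 + π / 2 = 2 * π := by ring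
    rw [hpi] at h5
    simp only [pderiv', deriv_const, Pi.zero_apply, zero_mul, Finset.sum_const_zero, zero_add,
      Real.cos_two_pi, mul_one] at h5
    have h6 := (integral_eq_zero_iff_of_nonneg (μ := Γ)
      (f := fun s : EuclideanSpace ℝ (Fin d) => 1 * s j * s i * s i * s j)
      (fun s => by
        have : 1 * s j * s i * s i * s j = (s i * s j) ^ 2 := by ring
        simp only [this]; exact sq_nonneg _)
      (Integrable.of_bound (C := 1) (by fun_prop) (by
        filter_upwards [hs] with s h using b4 s h))).1 (by simpa using h5.symm)
    filter_upwards [h6] with s h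
    have : (s i * s j) ^ 2 = 0 := by
      simp only [Pi.zero_apply] at h
      linarith
    exact pow_eq_zero_iff (two_ne_zero) |>.1 this
  intro i₀ θ
  have hall : ∀ᵐ s ∂Γ, ∀ i j : Fin d, i ≠ j → s i * s j = 0 := by
    rw [ae_all_iff]; intro i
    rw [ae_all_iff]; intro j
    by_cases h : i = j
    · simp [h]
    · filter_upwards [hax i j h] with s hs _ using hs
  have z : spow 0 (α - 1) = 0 := by simp [spow]
  rw [← integral_finsetSum]
  · apply integral_congr_ae
    filter_upwards [hall] with s h
    by_cases hz : s i₀ = 0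
    · simp [hz]
    · have h0 : ∀ j, j ≠ i₀ → s j = 0 := fun j hj =>
        (mul_eq_zero.1 (h i₀ j hj.symm)).resolve_left hz
      rw [Finset.sum_eq_single i₀ (fun j _ hj => by simp [h0 j hj]) (by simp),
        Finset.sum_eq_single i₀ (fun j _ hj => by simp [h0 j hj, z]) (by simp)]
  · intro j _
    refine Integrable.of_bound (C := 1 * |θ j| ^ (α - 1)) ?_ ?_
    · exact ((hcoord i₀).mul ((spow_meas (α - 1)).comp
        ((hcoord j).const_mul (θ j)))).aestronglyMeasurable
    · filter_upwards [hs] with s h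
      rw [Real.norm_eq_abs, abs_mul]
      have h2 : |θ j * s j| ≤ |θ j| := by
        rw [abs_mul]; exact mul_le_of_le_one_right (abs_nonneg _) (hc1 s h j)
      exact mul_le_mul (hc1 s h i₀) (spow_bound _ _ (by linarith) _ h2) (abs_nonneg _) zero_le_one
end

section
/- Let 1 < p < 2. Then for every real number s, the function t ↦ sin(st)/t^p is integrable on (0,∞) and ∫_0^{+∞} sin(st)/t^p dt = Γ(1−p) · cos(pπ/2) · s^{<p−1>}. -/
open MeasureTheory Real

lemma aux_int (p : ℝ) (hp1 : 1 < p) (hp2 : p < 2) (s : ℝ) :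
    IntegrableOn (fun t : ℝ => Real.sin (s * t) / t ^ p) (Set.Ioi 0) volume := by
  have hm : Measurable (fun t : ℝ => Real.sin (s * t) / t ^ p) := by fun_prop
  rw [← Set.Ioc_union_Ioi_eq_Ioi (zero_le_one' ℝ)]
  refine IntegrableOn.union ?_ ?_
  · have h1 : IntegrableOn (fun t : ℝ => |s| * t ^ (1 - p)) (Set.Ioc 0 1) volume := by
      have := (intervalIntegral.intervalIntegrable_rpow' (a := 0) (b := 1) (r := 1 - p) (by linarith))
      rw [intervalIntegrable_iff_integrableOn_Ioc_of_le zero_le_one] at this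
      exact this.const_mul _
    refine Integrable.mono' h1 hm.aestronglyMeasurable ?_
    refine (ae_restrict_iff' measurableSet_Ioc).2 (ae_of_all _ fun t ht => ?_)
    rw [norm_div, Real.norm_eq_abs, Real.norm_eq_abs, abs_of_pos (rpow_pos_of_pos ht.1 p),
      rpow_sub ht.1, rpow_one, ← mul_div_assoc]
    have := Real.abs_sin_le_abs (x := s * t)
    rw [abs_mul, abs_of_pos ht.1] at this
    have := rpow_pos_of_pos ht.1 p
    gcongr
  · have h1 : IntegrableOn (fun t : ℝ => t ^ (- p)) (Set.Ioi 1) volume :=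
      integrableOn_Ioi_rpow_of_lt (by linarith) one_pos
    refine Integrable.mono' h1 hm.aestronglyMeasurable ?_
    refine (ae_restrict_iff' measurableSet_Ioi).2 (ae_of_all _ fun t ht => ?_)
    have h0 : (0:ℝ) < t := lt_trans one_pos ht
    have := rpow_pos_of_pos h0 p
    rw [norm_div, Real.norm_eq_abs, Real.norm_eq_abs, abs_of_pos this,
      rpow_neg h0.le, ← one_div]
    have := Real.abs_sin_le_one (s * t)
    gcongr

lemma aux_laplace (x : ℝ) (hx : 0 < x) :
    ∫ t in Set.Ioi (0:ℝ), Real.sin t * Real.exp (-(x * t)) = 1 / (1 + x ^ 2) := by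
  have hre : ((-x : ℂ) + Complex.I).re < 0 := by simp [hx]
  have h := integral_exp_mul_complex_Ioi hre 0
  have hi := integrableOn_exp_mul_complex_Ioi hre 0
  have h2 := congrArg Complex.im h
  have h3 := integral_im hi
  simp only [RCLike.im_eq_complex_im] at h3
  rw [← h3] at h2
  have e : ∀ t : ℝ, (Complex.exp (((-x : ℂ) + Complex.I) * t)).im
      = Real.sin t * Real.exp (-(x * t)) := by
    intro t
    rw [Complex.exp_im]; simp [mul_comm]
  simp only [e] at h2
  rw [h2]
  simp [Complex.div_im, Complex.normSq_apply]
  ring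

lemma aux_beta (p : ℝ) (hp1 : 1 < p) (hp2 : p < 2) :
    ∫ x in Set.Ioi (0:ℝ), x ^ (p - 1) * (1 / (1 + x ^ 2)) = Real.Gamma (p/2) * Real.Gamma (1 - p/2) / 2 := by
  set μ := volume.restrict (Set.Ioi (0:ℝ)) with hμ
  let f : ℝ → ℝ → ℝ := fun x u => x ^ (p - 1) * rexp (-u * x ^ (2:ℝ)) * rexp (-u)
  have hm : Measurable (Function.uncurry f) := by unfold f; fun_prop
  have key : ∀ u : ℝ, 0 < u → ∫ x, f x u ∂μ = Real.Gamma (p/2) / 2 * (rexp (-u) * u ^ ((1 - p/2) - 1)) := by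
    intro u hu
    simp only [f]
    rw [integral_mul_const, integral_rpow_mul_exp_neg_mul_rpow (by norm_num) (by linarith) hu]
    rw [show -(p - 1 + 1) / 2 = 1 - p/2 - 1 by ring, show (p - 1 + 1) / 2 = p / 2 by ring]
    ring
  have hint : Integrable (Function.uncurry f) (μ.prod μ) := by
    rw [integrable_prod_iff' hm.aestronglyMeasurable]
    constructor
    · refine (ae_restrict_iff' measurableSet_Ioi).2 (ae_of_all _ fun u hu => ?_)
      exact (integrableOn_rpow_mul_exp_neg_mul_rpow (p := 2) (s := p - 1) (b := u) (by linarith) (by norm_num) hu).mul_const (rexp (-u))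
    · have : Integrable (fun u => Real.Gamma (p/2) / 2 * (rexp (-u) * u ^ ((1 - p/2) - 1))) μ :=
        (Real.GammaIntegral_convergent (by linarith)).const_mul _
      refine this.congr ?_
      refine (ae_restrict_iff' measurableSet_Ioi).2 (ae_of_all _ fun u hu => ?_)
      simp only
      rw [← key u hu]
      refine setIntegral_congr_fun measurableSet_Ioi fun x hx => ?_
      simp only [Function.uncurry]
      rw [Real.norm_of_nonneg]
      have := rpow_nonneg (le_of_lt hx) (p - 1)
      positivity
  have hsw := integral_integral_swap hint
  have h1 : ∫ x, ∫ u, f x u ∂μ ∂μ = ∫ x in Set.Ioi (0:ℝ), x ^ (p - 1) * (1 / (1 + x ^ 2)) := by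
    refine setIntegral_congr_fun measurableSet_Ioi fun x hx => ?_
    have : ∀ u, f x u = x ^ (p-1) * rexp (-(1 + x^2) * u) := by
      intro u
      simp only [f]
      rw [mul_assoc, ← Real.exp_add, rpow_two]
      ring_nf
    simp only [this]
    rw [integral_const_mul, integral_exp_mul_Ioi (by nlinarith [sq_nonneg x])]
    simp
    left
    rw [neg_div, ← div_neg]
    ring_nf
  have h2 : ∫ u, ∫ x, f x u ∂μ ∂μ = Real.Gamma (p/2) / 2 * Real.Gamma (1 - p/2) := by
    rw [Real.Gamma_eq_integral (by linarith : 0 < 1 - p/2), ← integral_const_mul]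
    exact setIntegral_congr_fun measurableSet_Ioi fun u hu => key u hu
  rw [← h1, hsw, h2]; ring

lemma aux_one (p : ℝ) (hp1 : 1 < p) (hp2 : p < 2) :
    ∫ t in Set.Ioi (0:ℝ), Real.sin t / t ^ p = Real.Gamma (1 - p) * Real.cos (p * π / 2) := by
  set μ := volume.restrict (Set.Ioi (0:ℝ)) with hμ
  let f : ℝ → ℝ → ℝ := fun x t => Real.sin t * (x ^ (p - 1) * rexp (-(t * x)))
  have hm : Measurable (Function.uncurry f) := by unfold f; fun_prop
  have hG : 0 < Real.Gamma p := Real.Gamma_pos_of_pos (by linarith)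
  have key : ∀ t : ℝ, 0 < t → ∫ x in Set.Ioi (0:ℝ), x ^ (p - 1) * rexp (-(t * x)) = Real.Gamma p / t ^ p := by
    intro t ht
    rw [Real.integral_rpow_mul_exp_neg_mul_Ioi (by linarith) ht, one_div, inv_rpow ht.le]
    field_simp
  have hint : Integrable (Function.uncurry f) (μ.prod μ) := by
    rw [integrable_prod_iff' hm.aestronglyMeasurable]
    constructor
    · refine (ae_restrict_iff' measurableSet_Ioi).2 (ae_of_all _ fun t ht => ?_)
      have := (integrableOn_rpow_mul_exp_neg_mul_rpow (p := 1) (s := p - 1) (b := t) (by linarith) (by norm_num) ht).const_mul (Real.sin t)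
      simpa [f, Function.uncurry, IntegrableOn] using this
    · have h := ((aux_int p hp1 hp2 1).norm).const_mul (Real.Gamma p)
      refine h.congr ?_
      refine (ae_restrict_iff' measurableSet_Ioi).2 (ae_of_all _ fun t ht => ?_)
      have e : ∫ x, ‖f x t‖ ∂μ = ∫ x in Set.Ioi (0:ℝ), |Real.sin t| * (x ^ (p - 1) * rexp (-(t * x))) := by
        refine setIntegral_congr_fun measurableSet_Ioi fun x hx => ?_
        have := rpow_nonneg (le_of_lt hx) (p - 1)
        simp only [f]
        rw [norm_mul, Real.norm_eq_abs, Real.norm_of_nonneg (by positivity)]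
      simp only [Function.uncurry]
      rw [e, integral_const_mul, key t ht, norm_div, one_mul, Real.norm_of_nonneg (rpow_nonneg (le_of_lt ht) p), Real.norm_eq_abs]
      ring
  have hsw := integral_integral_swap hint
  have h1 : ∫ x, ∫ t, f x t ∂μ ∂μ = ∫ x in Set.Ioi (0:ℝ), x ^ (p - 1) * (1 / (1 + x ^ 2)) := by
    refine setIntegral_congr_fun measurableSet_Ioi fun x hx => ?_
    rw [← aux_laplace x hx, ← integral_const_mul]
    refine integral_congr_ae (ae_of_all _ fun t => ?_)
    simp only [f]
    rw [mul_comm t x]; ring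
  have h2 : ∫ t, ∫ x, f x t ∂μ ∂μ = Real.Gamma p * ∫ t in Set.Ioi (0:ℝ), Real.sin t / t ^ p := by
    rw [← integral_const_mul]
    refine setIntegral_congr_fun measurableSet_Ioi fun t ht => ?_
    simp only [f]
    rw [integral_const_mul, key t ht]; ring
  rw [h1, h2, aux_beta p hp1 hp2, Real.Gamma_mul_Gamma_one_sub] at hsw
  have h3 := Real.Gamma_mul_Gamma_one_sub p
  have hs : 0 < Real.sin (π * (p / 2)) := Real.sin_pos_of_pos_of_lt_pi (by have := pi_pos; positivity) (by nlinarith [pi_pos])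
  have hc : Real.cos (π * (p / 2)) < 0 := Real.cos_neg_of_pi_div_two_lt_of_lt (by nlinarith [pi_pos]) (by nlinarith [pi_pos])
  rw [show π * p = 2 * (π * (p/2)) by ring, Real.sin_two_mul] at h3
  rw [show p * π / 2 = π * (p/2) by ring]
  apply mul_left_cancel₀ hG.ne'
  rw [← hsw, ← mul_assoc, h3]
  have hc' := hc.ne
  have hs' := hs.ne'
  generalize Real.cos (π * (p / 2)) = c at *
  generalize Real.sin (π * (p / 2)) = d at *
  field_simp

lemma aux_pos (p : ℝ) (hp1 : 1 < p) (hp2 : p < 2) (s : ℝ) (hs : 0 < s) :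
    ∫ t in Set.Ioi (0:ℝ), Real.sin (s * t) / t ^ p = Real.Gamma (1 - p) * Real.cos (p * π / 2) * s ^ (p - 1) := by
  have h := integral_comp_mul_left_Ioi (fun t => Real.sin t / t ^ p) 0 hs
  rw [mul_zero, aux_one p hp1 hp2] at h
  have e : ∫ t in Set.Ioi (0:ℝ), Real.sin (s * t) / t ^ p = s ^ p * ∫ t in Set.Ioi (0:ℝ), Real.sin (s * t) / (s * t) ^ p := by
    rw [← integral_const_mul]
    refine setIntegral_congr_fun measurableSet_Ioi fun t ht => ?_
    have := rpow_pos_of_pos hs p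
    rw [mul_rpow hs.le (le_of_lt ht)]
    field_simp
  rw [e, h, rpow_sub hs, rpow_one, smul_eq_mul]
  field_simp

theorem stmt3 (p : ℝ) (hp1 : 1 < p) (hp2 : p < 2) (s : ℝ) :
    IntegrableOn (fun t : ℝ => Real.sin (s * t) / t ^ p) (Set.Ioi 0) volume ∧
    ∫ t in Set.Ioi (0 : ℝ), Real.sin (s * t) / t ^ p
      = Real.Gamma (1 - p) * Real.cos (p * π / 2) * spow s (p - 1) := by
  refine ⟨aux_int p hp1 hp2 s, ?_⟩
  unfold spow
  rcases lt_trichotomy s 0 with h | h | h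
  · have := aux_pos p hp1 hp2 (-s) (by linarith)
    simp only [neg_mul, Real.sin_neg, neg_div, integral_neg] at this
    rw [Real.sign_of_neg h, abs_of_neg h]
    linarith
  · simp [h]
  · rw [Real.sign_of_pos h, abs_of_pos h, one_mul]
    exact aux_pos p hp1 hp2 s h
end
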